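/- arXiv:2409.19292 — 3 statements merged into one kernel-verified Lean document; each statement's English description precedes it below -/
import Mathlib

section
/- Let V be a finite type, let h ≥ 1 and τ ≥ 1 be natural numbers, and let 𝒞 be a finite family (a Finset) of h-element subsets of V such that every vertex of V belongs to at most τ members of 𝒞. Then the number of ordered pairs (C₁, C₂) ∈ 𝒞 × 𝒞 with C₁ ≠ C₂ and C₁ ∩ C₂ ≠ ∅ is at most h·τ·|𝒞|. -/
/-- In a family `𝒞` of `h`-element subsets of `V` in which every vertex lies
in at most `τ` members, the number of ordered pairs of distinct intersecting members is
at most `h·τ·|𝒞|`. -/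
theorem intersecting_pairs_upper_bound (V : Type*) [DecidableEq V]
    (h τ : ℕ) (hh : 1 ≤ h) (hτ : 1 ≤ τ)
    (𝒞 : Finset (Finset V)) (hsize : ∀ C ∈ 𝒞, C.card = h)
    (hdeg : ∀ v : V, (𝒞.filter (fun C => v ∈ C)).card ≤ τ) :
    ((𝒞 ×ˢ 𝒞).filter (fun p => p.1 ≠ p.2 ∧ (p.1 ∩ p.2).Nonempty)).card ≤ h * τ * 𝒞.card := by
  have hsub : (𝒞 ×ˢ 𝒞).filter (fun p => p.1 ≠ p.2 ∧ (p.1 ∩ p.2).Nonempty) ⊆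
      𝒞.biUnion fun C => (C.biUnion fun v => 𝒞.filter (fun D => v ∈ D)).image (Prod.mk C) := by
    rintro ⟨C, D⟩ hp
    obtain ⟨hCD, -, v, hv⟩ := Finset.mem_filter.mp hp
    obtain ⟨hC, hD⟩ := Finset.mem_product.mp hCD
    obtain ⟨hvC, hvD⟩ := Finset.mem_inter.mp hv
    exact Finset.mem_biUnion.mpr ⟨C, hC, Finset.mem_image_of_mem _
      (Finset.mem_biUnion.mpr ⟨v, hvC, Finset.mem_filter.mpr ⟨hD, hvD⟩⟩)⟩
  rw [mul_comm (h * τ)]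
  refine (Finset.card_le_card hsub).trans (Finset.card_biUnion_le_card_mul _ _ _ fun C hC => ?_)
  rw [← hsize C hC]
  exact Finset.card_image_le.trans (Finset.card_biUnion_le_card_mul _ _ _ fun v _ => hdeg v)
end

section
/- Let G be a tripartite simple graph whose vertex set is the disjoint union of finite sets A, B, C, with every edge joining two distinct parts, and let t ≥ 1 be a natural number. Let G′ be the simple graph on vertex set A ⊔ (B × Fin t) ⊔ C whose edges are: {a, c} for every edge {a, c} of G with a ∈ A, c ∈ C; {a, (b, i)} for every edge {a, b} of G with a ∈ A, b ∈ B and every i ∈ Fin t; and {(b, i), c} for every edge {b, c} of G with b ∈ B, c ∈ C and every i ∈ Fin t. Then the number of triangles in G′ equals t times the number of triangles in G. In particular, if G is triangle-free then so is G′, and if G contains a triangle then G′ contains at least t triangles. -/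
open scoped Classical

/-- The blow-up `G′` of a tripartite graph `G` on parts `A, B, C`, in which every vertex
of the middle part `B` is duplicated `t` times: edges are `{a, c}`, `{a, (b,i)}` and
`{(b,i), c}` for corresponding edges of `G`. -/
noncomputable def middleBlowup {A B C : Type*} (G : SimpleGraph (A ⊕ B ⊕ C)) (t : ℕ) :
    SimpleGraph (A ⊕ (B × Fin t) ⊕ C) :=
  SimpleGraph.fromRel (fun x y =>
    match x, y with
    | Sum.inl a, Sum.inr (Sum.inr c) => G.Adj (Sum.inl a) (Sum.inr (Sum.inr c))
    | Sum.inl a, Sum.inr (Sum.inl (b, _)) => G.Adj (Sum.inl a) (Sum.inr (Sum.inl b))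
    | Sum.inr (Sum.inl (b, _)), Sum.inr (Sum.inr c) =>
        G.Adj (Sum.inr (Sum.inl b)) (Sum.inr (Sum.inr c))
    | _, _ => False)

/-- In a tripartite graph, the triangles correspond to the pairwise adjacent triples with one
vertex in each part. -/
theorem card_cliqueFinset_three_of_tripartite {X Y Z : Type*} [Fintype X] [Fintype Y] [Fintype Z]
    [DecidableEq (X ⊕ Y ⊕ Z)] (H : SimpleGraph (X ⊕ Y ⊕ Z)) [DecidableRel H.Adj]
    (hX : ∀ x x', ¬ H.Adj (Sum.inl x) (Sum.inl x'))
    (hY : ∀ y y', ¬ H.Adj (Sum.inr (Sum.inl y)) (Sum.inr (Sum.inl y')))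
    (hZ : ∀ z z', ¬ H.Adj (Sum.inr (Sum.inr z)) (Sum.inr (Sum.inr z'))) :
    (H.cliqueFinset 3).card = Nat.card {p : X × Y × Z //
      H.Adj (Sum.inl p.1) (Sum.inr (Sum.inl p.2.1)) ∧
      H.Adj (Sum.inl p.1) (Sum.inr (Sum.inr p.2.2)) ∧
      H.Adj (Sum.inr (Sum.inl p.2.1)) (Sum.inr (Sum.inr p.2.2))} := by
  rw [Nat.card_eq_fintype_card, Fintype.card_subtype]
  symm
  refine Finset.card_bij
    (fun p _ => {Sum.inl p.1, Sum.inr (Sum.inl p.2.1), Sum.inr (Sum.inr p.2.2)}) ?_ ?_ ?_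
  · rintro ⟨x, y, z⟩ h
    rw [SimpleGraph.mem_cliqueFinset_iff, SimpleGraph.is3Clique_triple_iff]
    simpa using h
  · rintro ⟨x, y, z⟩ - ⟨x', y', z'⟩ - h
    have hx := Finset.ext_iff.1 h (Sum.inl x)
    have hy := Finset.ext_iff.1 h (Sum.inr (Sum.inl y))
    have hz := Finset.ext_iff.1 h (Sum.inr (Sum.inr z))
    simp only [Finset.mem_insert, Finset.mem_singleton] at hx hy hz
    simp_all
  · intro s hs
    rw [SimpleGraph.mem_cliqueFinset_iff, SimpleGraph.is3Clique_iff] at hs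
    obtain ⟨u, v, w, huv, huw, hvw, rfl⟩ := hs
    have hvu := huv.symm
    have hwu := huw.symm
    have hwv := hvw.symm
    rcases u with x | y | z <;> rcases v with x' | y' | z' <;> rcases w with x'' | y'' | z'' <;>
      first
      | exact absurd ‹_› (hX _ _)
      | exact absurd ‹_› (hY _ _)
      | exact absurd ‹_› (hZ _ _)
      | exact ⟨(‹X›, ‹Y›, ‹Z›), by simp [*], by
          ext
          simp only [Finset.mem_insert, Finset.mem_singleton] <;> tauto⟩

/-- For a tripartite graph `G` with all edges between distinct parts, the
blow-up `G′` duplicating each middle vertex `t ≥ 1` times has exactly `t` times as many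
triangles as `G`; in particular `G′` is triangle-free iff `G` is, and if `G` has a
triangle then `G′` has at least `t` triangles. -/
theorem middleBlowup_triangle_count {A B C : Type*}
    [Fintype A] [Fintype B] [Fintype C] [DecidableEq A] [DecidableEq B] [DecidableEq C]
    (G : SimpleGraph (A ⊕ B ⊕ C)) (t : ℕ) (ht : 1 ≤ t)
    (hA : ∀ a a', ¬ G.Adj (Sum.inl a) (Sum.inl a'))
    (hB : ∀ b b', ¬ G.Adj (Sum.inr (Sum.inl b)) (Sum.inr (Sum.inl b')))
    (hC : ∀ c c', ¬ G.Adj (Sum.inr (Sum.inr c)) (Sum.inr (Sum.inr c'))) :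
    ((middleBlowup G t).cliqueFinset 3).card = t * (G.cliqueFinset 3).card ∧
      (G.CliqueFree 3 → (middleBlowup G t).CliqueFree 3) ∧
      ((G.cliqueFinset 3).Nonempty → t ≤ ((middleBlowup G t).cliqueFinset 3).card) := by
  have hcard : ((middleBlowup G t).cliqueFinset 3).card = t * (G.cliqueFinset 3).card := by
    rw [card_cliqueFinset_three_of_tripartite G hA hB hC,
      card_cliqueFinset_three_of_tripartite (middleBlowup G t)
        (by simp [middleBlowup]) (by simp [middleBlowup]) (by simp [middleBlowup])]
    conv_rhs => rw [← Nat.card_fin t, ← Nat.card_prod]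
    refine Nat.card_congr
      { toFun := fun p => (p.1.2.1.2, ⟨(p.1.1, p.1.2.1.1, p.1.2.2), ?_⟩)
        invFun := fun q => ⟨(q.2.1.1, (q.2.1.2.1, q.1), q.2.1.2.2), ?_⟩
        left_inv := fun _ => rfl
        right_inv := fun _ => rfl }
    · simpa [middleBlowup] using p.2
    · simpa [middleBlowup] using q.2.2
  refine ⟨hcard, fun h => ?_, fun h => ?_⟩
  · rw [← SimpleGraph.cliqueFinset_eq_empty_iff] at h ⊢
    rw [← Finset.card_eq_zero, hcard, h, Finset.card_empty, mul_zero]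
  · rw [hcard]
    exact Nat.le_mul_of_pos_right t h.card_pos
end

section
/- Let h ≥ 3 and ℓ ≥ 1 be natural numbers, and let G be a tripartite simple graph on disjoint finite parts A, B, C with every edge joining two distinct parts. Define the directed graph G′ on vertex set A ⊔ (B × Fin ℓ × Fin (h−2)) ⊔ C with exactly the following edges: c → a whenever {c, a} is an edge of G with c ∈ C, a ∈ A; a → (b, i, 0) whenever {a, b} is an edge of G with a ∈ A, b ∈ B, for every i ∈ Fin ℓ; (b, i, h−3) → c whenever {b, c} is an edge of G with b ∈ B, c ∈ C, for every i ∈ Fin ℓ; and (b, i, j) → (b, i′, j+1) for every b ∈ B, all i, i′ ∈ Fin ℓ, and every j < h−3. Then: (1) G′ contains a directed cycle of length h if and only if G contains a triangle (necessarily with one vertex in each of A, B, C); and (2) if G contains s triangles, then G′ contains at least s·ℓ^{h−2} directed cycles of length h. -/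
open scoped Classical

/-- The directed edge relation of the graph `G′` of the lower-bound reduction: edges
`c → a`, `a → (b, i, 0)`, `(b, i, h−3) → c` (for corresponding edges of the tripartite
graph `G`) and `(b, i, j) → (b, i′, j+1)` within the middle layers. -/
def cycleReduceRel {A B C : Type*} (G : SimpleGraph (A ⊕ B ⊕ C)) (h ℓ : ℕ) :
    (A ⊕ (B × Fin ℓ × Fin (h - 2)) ⊕ C) → (A ⊕ (B × Fin ℓ × Fin (h - 2)) ⊕ C) → Prop :=
  fun x y =>
    match x, y with
    | Sum.inr (Sum.inr c), Sum.inl a => G.Adj (Sum.inr (Sum.inr c)) (Sum.inl a)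
    | Sum.inl a, Sum.inr (Sum.inl (b, _, j)) =>
        j.val = 0 ∧ G.Adj (Sum.inl a) (Sum.inr (Sum.inl b))
    | Sum.inr (Sum.inl (b, _, j)), Sum.inr (Sum.inr c) =>
        j.val = h - 3 ∧ G.Adj (Sum.inr (Sum.inl b)) (Sum.inr (Sum.inr c))
    | Sum.inr (Sum.inl (b, _, j)), Sum.inr (Sum.inl (b', _, j')) =>
        b' = b ∧ j'.val = j.val + 1
    | _, _ => False

/-- `W` is the vertex set of a directed cycle of length `h` for the edge relation `E`:
there is an injective `v : ZMod h → V` with range `W` following edges of `E`. -/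
def IsDirCycleSet {V : Type*} (E : V → V → Prop) (h : ℕ) (W : Finset V) : Prop :=
  ∃ v : ZMod h → V, Function.Injective v ∧ (∀ i, E (v i) (v (i + 1))) ∧
    Set.range v = (W : Set V)

section CycleReduce

variable {A B C : Type*}

/-- The position of a vertex of `G′` in the cyclic order of the `n + 3` layers. -/
def cycleReduceLayer (n ℓ : ℕ) : (A ⊕ (B × Fin ℓ × Fin (n + 3 - 2)) ⊕ C) → ℕ
  | Sum.inl _ => 0
  | Sum.inr (Sum.inl (_, _, j)) => j.val + 1
  | Sum.inr (Sum.inr _) => n + 2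

theorem cycleReduceLayer_of_rel (G : SimpleGraph (A ⊕ B ⊕ C)) (n ℓ : ℕ)
    {x y : A ⊕ (B × Fin ℓ × Fin (n + 3 - 2)) ⊕ C} (hxy : cycleReduceRel G (n + 3) ℓ x y) :
    (cycleReduceLayer n ℓ y : ZMod (n + 3)) = cycleReduceLayer n ℓ x + 1 := by
  have hz : ((n + 3 : ℕ) : ZMod (n + 3)) = 0 := ZMod.natCast_self _
  rcases x with a | ⟨b, i, j⟩ | c <;> rcases y with a' | ⟨b', i', j'⟩ | c' <;>
    simp only [cycleReduceRel] at hxy <;> simp only [cycleReduceLayer]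
  · simp [hxy.1]
  · simp [hxy.2]
  · have : j.val = n := hxy.1
    rw [this]
    push_cast
    ring
  · rw [← Nat.cast_succ, hz, Nat.cast_zero]

theorem cycleReduceLayer_lt (n ℓ : ℕ) (x : A ⊕ (B × Fin ℓ × Fin (n + 3 - 2)) ⊕ C) :
    cycleReduceLayer n ℓ x < n + 3 := by
  rcases x with a | ⟨b, i, j⟩ | c <;> simp only [cycleReduceLayer] <;> omega

/-- A closed walk of length `n + 3` in `G′` that starts in `A` projects to a triangle of `G`. -/
theorem exists_adj_of_closed_walk (G : SimpleGraph (A ⊕ B ⊕ C)) (n ℓ : ℕ)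
    (u : ℕ → A ⊕ (B × Fin ℓ × Fin (n + 3 - 2)) ⊕ C)
    (hu : ∀ k, cycleReduceRel G (n + 3) ℓ (u k) (u (k + 1)))
    (a : A) (h_start : u 0 = Sum.inl a) (h_end : u (n + 3) = Sum.inl a) :
    ∃ x y z : A ⊕ B ⊕ C, G.Adj x y ∧ G.Adj y z ∧ G.Adj z x := by
  obtain ⟨b, hab, hb⟩ : ∃ b, G.Adj (Sum.inl a) (Sum.inr (Sum.inl b)) ∧
      ∃ i j, u 1 = Sum.inr (Sum.inl (b, i, j)) ∧ j.val = 0 := by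
    have h0 := hu 0
    rw [h_start, zero_add] at h0
    rcases h1 : u 1 with a' | ⟨b, i, j⟩ | c <;> rw [h1] at h0 <;>
      simp only [cycleReduceRel] at h0
    exact ⟨b, h0.2, i, j, rfl, h0.1⟩
  have h_mid : ∀ k ≤ n, ∃ i j, u (k + 1) = Sum.inr (Sum.inl (b, i, j)) ∧ j.val = k := by
    intro k
    induction k with
    | zero => exact fun _ => hb
    | succ k ih =>
      intro hk
      obtain ⟨i, j, hkj, hj⟩ := ih (by omega)
      have h0 := hu (k + 1)
      rw [hkj] at h0
      rcases h1 : u (k + 1 + 1) with a' | ⟨b', i', j'⟩ | c <;> rw [h1] at h0 <;>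
        simp only [cycleReduceRel] at h0
      · obtain ⟨rfl, hj'⟩ := h0
        exact ⟨i', j', rfl, by omega⟩
      · omega
  obtain ⟨i, j, hnj, hj⟩ := h_mid n le_rfl
  have h0 := hu (n + 1)
  have h2 := hu (n + 2)
  rw [h_end] at h2
  rw [hnj] at h0
  rcases h1 : u (n + 2) with a' | ⟨b', i', j'⟩ | c <;> rw [h1] at h0 h2 <;>
    simp only [cycleReduceRel] at h0 h2
  exact ⟨_, _, _, hab, h0.2, h2⟩

theorem exists_triangle_of_isDirCycleSet (G : SimpleGraph (A ⊕ B ⊕ C)) (n ℓ : ℕ)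
    {W : Finset (A ⊕ (B × Fin ℓ × Fin (n + 3 - 2)) ⊕ C)}
    (hW : IsDirCycleSet (cycleReduceRel G (n + 3) ℓ) (n + 3) W) :
    ∃ x y z : A ⊕ B ⊕ C, G.Adj x y ∧ G.Adj y z ∧ G.Adj z x := by
  obtain ⟨v, -, hv, -⟩ := hW
  have h_layer : ∀ k : ℕ, (cycleReduceLayer n ℓ (v k) : ZMod (n + 3)) =
      cycleReduceLayer n ℓ (v 0) + k := by
    intro k
    induction k with
    | zero => simp
    | succ k ih =>
      rw [Nat.cast_succ, cycleReduceLayer_of_rel G n ℓ (hv k), ih, add_assoc]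
  obtain ⟨m, hm⟩ : ∃ m : ℕ, cycleReduceLayer n ℓ (v m) = 0 := by
    refine ⟨n + 3 - cycleReduceLayer n ℓ (v 0), ?_⟩
    have h1 := h_layer (n + 3 - cycleReduceLayer n ℓ (v 0))
    rw [← Nat.cast_add, Nat.add_sub_cancel' (cycleReduceLayer_lt n ℓ _).le,
      ZMod.natCast_self, ZMod.natCast_eq_zero_iff] at h1
    exact Nat.eq_zero_of_dvd_of_lt h1 (cycleReduceLayer_lt n ℓ _)
  rcases h_start : v m with a | ⟨b, i, j⟩ | c <;> rw [h_start] at hm <;>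
    simp only [cycleReduceLayer] at hm
  · refine exists_adj_of_closed_walk G n ℓ (fun k => v (m + k)) (fun k => ?_) a ?_ ?_
    · have := hv (m + k)
      rwa [add_assoc, ← Nat.cast_succ] at this
    · simpa using h_start
    · simp only [ZMod.natCast_self, add_zero, h_start]
  · omega
  · omega

/-- The vertex at position `k` on the `h`-cycle of `G′` that goes through `a`, the copies
`(b, f j, j)` of `b`, and `c`. -/
def liftedVertex {n ℓ : ℕ} (t : A × B × C) (f : Fin (n + 3 - 2) → Fin ℓ) (k : ℕ) :
    A ⊕ (B × Fin ℓ × Fin (n + 3 - 2)) ⊕ C :=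
  if k = 0 then Sum.inl t.1
  else if hk : k - 1 < n + 3 - 2 then Sum.inr (Sum.inl (t.2.1, f ⟨k - 1, hk⟩, ⟨k - 1, hk⟩))
  else Sum.inr (Sum.inr t.2.2)

theorem layer_liftedVertex {n ℓ : ℕ} (t : A × B × C) (f : Fin (n + 3 - 2) → Fin ℓ) {k : ℕ}
    (hk : k < n + 3) : cycleReduceLayer n ℓ (liftedVertex t f k) = k := by
  unfold liftedVertex
  split_ifs <;> simp only [cycleReduceLayer] <;> omega

/-- The vertex set of the `h`-cycle of `G′` given by `liftedVertex`. -/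
noncomputable def liftedCycle {n ℓ : ℕ} (t : A × B × C) (f : Fin (n + 3 - 2) → Fin ℓ) :
    Finset (A ⊕ (B × Fin ℓ × Fin (n + 3 - 2)) ⊕ C) :=
  (Finset.range (n + 3)).image (liftedVertex t f)

theorem liftedCycle_injective {n ℓ : ℕ} :
    Function.Injective (fun p : (A × B × C) × (Fin (n + 3 - 2) → Fin ℓ) =>
      liftedCycle p.1 p.2) := by
  rintro ⟨t, f⟩ ⟨t', f'⟩ hp
  have h_eq : ∀ k < n + 3, liftedVertex t f k = liftedVertex t' f' k := by
    intro k hk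
    have h_mem : liftedVertex t f k ∈ liftedCycle t' f' := by
      rw [← show liftedCycle t f = liftedCycle t' f' from hp]
      exact Finset.mem_image_of_mem _ (Finset.mem_range.2 hk)
    obtain ⟨k', hk', he⟩ := Finset.mem_image.1 h_mem
    have h_layer := congrArg (cycleReduceLayer n ℓ) he
    rw [layer_liftedVertex t' f' (Finset.mem_range.1 hk'), layer_liftedVertex t f hk] at h_layer
    rw [← he, h_layer]
  have h_first : t.1 = t'.1 := by simpa [liftedVertex] using h_eq 0 (by omega)
  have h_mid : ∀ j : Fin (n + 3 - 2), t.2.1 = t'.2.1 ∧ f j = f' j := by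
    intro j
    have := h_eq (j.val + 1) (by omega)
    have hj : j.val ≤ n := by omega
    simpa [liftedVertex, hj] using this
  have h_last : t.2.2 = t'.2.2 := by simpa [liftedVertex] using h_eq (n + 2) (by omega)
  have h_second := (h_mid ⟨0, by omega⟩).1
  exact Prod.ext (Prod.ext h_first (Prod.ext h_second h_last)) (funext fun j => (h_mid j).2)

/-- The triple `(a, b, c)` spans a triangle of `G`. -/
def IsTripartiteTriangle (G : SimpleGraph (A ⊕ B ⊕ C)) (t : A × B × C) : Prop :=
  G.Adj (Sum.inl t.1) (Sum.inr (Sum.inl t.2.1)) ∧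
    G.Adj (Sum.inr (Sum.inl t.2.1)) (Sum.inr (Sum.inr t.2.2)) ∧
    G.Adj (Sum.inr (Sum.inr t.2.2)) (Sum.inl t.1)

theorem IsTripartiteTriangle.rel_liftedVertex {G : SimpleGraph (A ⊕ B ⊕ C)} {n ℓ : ℕ}
    {t : A × B × C} (ht : IsTripartiteTriangle G t) (f : Fin (n + 3 - 2) → Fin ℓ) {k : ℕ}
    (hk : k < n + 2) :
    cycleReduceRel G (n + 3) ℓ (liftedVertex t f k) (liftedVertex t f (k + 1)) := by
  obtain ⟨hab, hbc, -⟩ := ht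
  unfold liftedVertex
  split_ifs <;> simp only [cycleReduceRel] <;> first | omega | skip
  · exact ⟨by omega, hab⟩
  · exact ⟨trivial, by omega⟩
  · exact ⟨by omega, hbc⟩

theorem IsTripartiteTriangle.isDirCycleSet_liftedCycle {G : SimpleGraph (A ⊕ B ⊕ C)} {n ℓ : ℕ}
    {t : A × B × C} (ht : IsTripartiteTriangle G t) (f : Fin (n + 3 - 2) → Fin ℓ) :
    IsDirCycleSet (cycleReduceRel G (n + 3) ℓ) (n + 3) (liftedCycle t f) := by
  refine ⟨fun i => liftedVertex t f i.val, fun i i' hi => ?_, fun i => ?_, ?_⟩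
  · have := congrArg (cycleReduceLayer n ℓ) hi
    simp only [layer_liftedVertex t f (ZMod.val_lt _)] at this
    exact ZMod.val_injective _ this
  · have hlt := ZMod.val_lt i
    dsimp only
    rw [ZMod.val_add, ZMod.val_one'' (by omega)]
    rcases Nat.lt_or_ge i.val (n + 2) with hi | hi
    · rw [Nat.mod_eq_of_lt (by omega)]
      exact ht.rel_liftedVertex f hi
    · obtain hi : i.val = n + 2 := by omega
      rw [hi, Nat.mod_self]
      simpa [liftedVertex, cycleReduceRel] using ht.2.2
  · ext x
    simp only [liftedCycle, Set.mem_range, Finset.coe_image, Set.mem_image, Finset.mem_coe,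
      Finset.mem_range]
    constructor
    · rintro ⟨i, rfl⟩
      exact ⟨i.val, ZMod.val_lt i, rfl⟩
    · rintro ⟨k, hk, rfl⟩
      exact ⟨k, by rw [ZMod.val_natCast_of_lt hk]⟩

theorem exists_isTripartiteTriangle_of_adj {G : SimpleGraph (A ⊕ B ⊕ C)}
    (hA : ∀ a a', ¬ G.Adj (Sum.inl a) (Sum.inl a'))
    (hB : ∀ b b', ¬ G.Adj (Sum.inr (Sum.inl b)) (Sum.inr (Sum.inl b')))
    (hC : ∀ c c', ¬ G.Adj (Sum.inr (Sum.inr c)) (Sum.inr (Sum.inr c')))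
    {x y z : A ⊕ B ⊕ C} (hxy : G.Adj x y) (hyz : G.Adj y z) (hzx : G.Adj z x) :
    ∃ t : A × B × C, IsTripartiteTriangle G t ∧
      ({Sum.inl t.1, Sum.inr (Sum.inl t.2.1), Sum.inr (Sum.inr t.2.2)} : Set (A ⊕ B ⊕ C)) =
        {x, y, z} := by
  rcases x with a | b | c <;> rcases y with a' | b' | c' <;>
    first
    | exact absurd hxy (hA _ _)
    | exact absurd hxy (hB _ _)
    | exact absurd hxy (hC _ _)
    | skip
  all_goals
    rcases z with a₂ | b₂ | c₂ <;>
    first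
    | exact absurd hyz (hA _ _)
    | exact absurd hyz (hB _ _)
    | exact absurd hyz (hC _ _)
    | exact absurd hzx (hA _ _)
    | exact absurd hzx (hB _ _)
    | exact absurd hzx (hC _ _)
    | skip
  · exact ⟨(a, b', c₂), ⟨hxy, hyz, hzx⟩, rfl⟩
  · exact ⟨(a, b₂, c'), ⟨hzx.symm, hyz.symm, hxy.symm⟩, by grind⟩
  · exact ⟨(a', b, c₂), ⟨hxy.symm, hzx.symm, hyz.symm⟩, by grind⟩
  · exact ⟨(a₂, b, c'), ⟨hzx, hxy, hyz⟩, by grind⟩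
  · exact ⟨(a', b₂, c), ⟨hyz, hzx, hxy⟩, by grind⟩
  · exact ⟨(a₂, b', c), ⟨hyz.symm, hxy.symm, hzx.symm⟩, by grind⟩

end CycleReduce

/-- The reduction from unbalanced triangle detection to approximate
`h`-cycle counting: (1) the layered directed graph `G′` has a directed `h`-cycle iff the
tripartite graph `G` has a triangle; (2) if `G` has `s` triangles then `G′` has at least
`s·ℓ^{h−2}` directed `h`-cycles. -/
theorem cycleReduce_correct {A B C : Type*}
    [Fintype A] [Fintype B] [Fintype C] [DecidableEq A] [DecidableEq B] [DecidableEq C]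
    (h ℓ : ℕ) (hh : 3 ≤ h) (hℓ : 1 ≤ ℓ)
    (G : SimpleGraph (A ⊕ B ⊕ C))
    (hA : ∀ a a', ¬ G.Adj (Sum.inl a) (Sum.inl a'))
    (hB : ∀ b b', ¬ G.Adj (Sum.inr (Sum.inl b)) (Sum.inr (Sum.inl b')))
    (hC : ∀ c c', ¬ G.Adj (Sum.inr (Sum.inr c)) (Sum.inr (Sum.inr c')))
    (s : ℕ) (hs : (G.cliqueFinset 3).card = s) :
    ((∃ W : Finset (A ⊕ (B × Fin ℓ × Fin (h - 2)) ⊕ C),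
        IsDirCycleSet (cycleReduceRel G h ℓ) h W) ↔
      (∃ x y z : A ⊕ B ⊕ C, G.Adj x y ∧ G.Adj y z ∧ G.Adj z x)) ∧
    s * ℓ ^ (h - 2) ≤
      Set.ncard {W : Finset (A ⊕ (B × Fin ℓ × Fin (h - 2)) ⊕ C) |
        IsDirCycleSet (cycleReduceRel G h ℓ) h W} := by
  obtain ⟨n, rfl⟩ : ∃ n, h = n + 3 := ⟨h - 3, by omega⟩
  refine ⟨⟨fun ⟨W, hW⟩ => exists_triangle_of_isDirCycleSet G n ℓ hW, ?_⟩, ?_⟩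
  · rintro ⟨x, y, z, hxy, hyz, hzx⟩
    obtain ⟨t, ht, -⟩ := exists_isTripartiteTriangle_of_adj hA hB hC hxy hyz hzx
    exact ⟨_, ht.isDirCycleSet_liftedCycle fun _ => ⟨0, hℓ⟩⟩
  · set T : Finset (A × B × C) := Finset.univ.filter (IsTripartiteTriangle G)
    have h_card : s ≤ T.card := by
      rw [← hs]
      refine (Finset.card_le_card fun K hK => ?_).trans (Finset.card_image_le
        (f := fun t : A × B × C => ({Sum.inl t.1, Sum.inr (Sum.inl t.2.1),
          Sum.inr (Sum.inr t.2.2)} : Finset (A ⊕ B ⊕ C))))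
      obtain ⟨x, y, z, hxy, hxz, hyz, rfl⟩ :=
        SimpleGraph.is3Clique_iff.1 ((SimpleGraph.mem_cliqueFinset_iff).1 hK)
      obtain ⟨t, ht, h_eq⟩ := exists_isTripartiteTriangle_of_adj hA hB hC hxy hyz hxz.symm
      refine Finset.mem_image.2 ⟨t, Finset.mem_filter.2 ⟨Finset.mem_univ _, ht⟩, ?_⟩
      apply Finset.coe_injective
      simpa using h_eq
    calc s * ℓ ^ (n + 3 - 2)
        ≤ T.card * ℓ ^ (n + 3 - 2) := Nat.mul_le_mul_right _ h_card
      _ = (T ×ˢ (Finset.univ : Finset (Fin (n + 3 - 2) → Fin ℓ))).card := by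
        simp [Finset.card_product]
      _ = Set.ncard (Set.image (fun p : (A × B × C) × (Fin (n + 3 - 2) → Fin ℓ) =>
            liftedCycle p.1 p.2) (T ×ˢ (Finset.univ : Finset (Fin (n + 3 - 2) → Fin ℓ)) :
              Finset _)) := by
        rw [Set.ncard_image_of_injective _ liftedCycle_injective, Set.ncard_coe_finset]
      _ ≤ _ := by
        refine Set.ncard_le_ncard ?_ (Set.toFinite _)
        rintro _ ⟨⟨t, f⟩, hp, rfl⟩
        have ht := (Finset.mem_filter.1 (Finset.mem_product.1 (Finset.mem_coe.1 hp)).1).2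
        exact IsTripartiteTriangle.isDirCycleSet_liftedCycle ht f
end
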